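/- k₀(n) is asymptotic to 2·log₂ n; that is, for every ε > 0 there is N such that for all n ≥ N, (2−ε)·log₂ n ≤ k₀(n) ≤ (2+ε)·log₂ n. -/

import Mathlib

/-- `fExp n k` is the expected number of `k`-cliques in `G_{n,1/2}`,
i.e. `C(n,k) · 2^{-C(k,2)}`. -/
noncomputable def fExp (n k : ℕ) : ℝ := (n.choose k : ℝ) / 2 ^ (k.choose 2)

/-- `kZero n = min {k : fExp n k < 1}`. -/
noncomputable def kZero (n : ℕ) : ℕ := sInf {k | fExp n k < 1}

/-- The elementary lower bound `(n / k) ^ k ≤ n.choose k`. -/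
theorem div_pow_le_choose {n k : ℕ} (hkn : k ≤ n) : ((n : ℝ) / k) ^ k ≤ n.choose k := by
  induction k generalizing n with
  | zero => simp
  | succ k ih =>
    obtain ⟨m, rfl⟩ : ∃ m, n = m + 1 := ⟨n - 1, by lia⟩
    have hkm : k ≤ m := by lia
    have hstep : (((m + 1 : ℕ) : ℝ) / (k + 1 : ℕ)) ^ k ≤ ((m : ℝ) / k) ^ k := by
      rcases Nat.eq_zero_or_pos k with rfl | hk
      · simp
      have hk' : (0 : ℝ) < k := by exact_mod_cast hk
      have hkm' : (k : ℝ) ≤ m := by exact_mod_cast hkm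
      refine pow_le_pow_left₀ (by positivity) ?_ k
      rw [div_le_div_iff₀ (by positivity) hk']
      push_cast
      nlinarith
    have hrec : ((m + 1 : ℕ) : ℝ) * m.choose k = (m + 1).choose (k + 1) * (k + 1 : ℕ) := by
      exact_mod_cast Nat.add_one_mul_choose_eq m k
    calc (((m + 1 : ℕ) : ℝ) / (k + 1 : ℕ)) ^ (k + 1)
        ≤ m.choose k * (((m + 1 : ℕ) : ℝ) / (k + 1 : ℕ)) := by
          rw [pow_succ]
          exact mul_le_mul_of_nonneg_right (hstep.trans (ih hkm)) (by positivity)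
      _ = (m + 1).choose (k + 1) := by
          rw [mul_div_assoc', div_eq_iff (by positivity), ← hrec, mul_comm]

theorem two_pow_choose_two_sq (k : ℕ) :
    ((2 : ℝ) ^ k.choose 2) ^ 2 = (2 ^ (k - 1)) ^ k := by
  rw [← pow_mul, ← pow_mul, Nat.choose_two_right,
    Nat.div_mul_cancel (Nat.even_mul_pred_self k).two_dvd, mul_comm]

theorem fExp_lt_one {n k : ℕ} (hk : k ≠ 0) (h : (n : ℝ) ^ 2 < 2 ^ (k - 1)) :
    fExp n k < 1 := by
  rw [fExp, div_lt_one (by positivity)]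
  refine lt_of_pow_lt_pow_left₀ 2 (by positivity) ?_
  have hchoose : (n.choose k : ℝ) ≤ (n : ℝ) ^ k := by exact_mod_cast Nat.choose_le_pow n k
  calc (n.choose k : ℝ) ^ 2 ≤ ((n : ℝ) ^ k) ^ 2 := by gcongr
    _ = ((n : ℝ) ^ 2) ^ k := pow_right_comm _ _ _
    _ < (2 ^ (k - 1)) ^ k := pow_lt_pow_left₀ h (by positivity) hk
    _ = _ := (two_pow_choose_two_sq k).symm

theorem one_le_fExp {n k : ℕ} (h : (k : ℝ) ^ 2 * 2 ^ (k - 1) ≤ (n : ℝ) ^ 2) :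
    1 ≤ fExp n k := by
  rcases Nat.eq_zero_or_pos k with rfl | hk
  · simp [fExp]
  have hk' : (0 : ℝ) < k := by exact_mod_cast hk
  have hkn : k ≤ n := by
    have : (k : ℝ) ≤ n := by
      refine (pow_le_pow_iff_left₀ (by positivity) (by positivity) two_ne_zero).mp ?_
      exact (le_mul_of_one_le_right (by positivity) (one_le_pow₀ one_le_two)).trans h
    exact_mod_cast this
  rw [fExp, one_le_div (by positivity)]
  refine (pow_le_pow_iff_left₀ (by positivity) (by positivity) two_ne_zero).mp ?_
  have hchoose : ((n : ℝ) / k) ^ k ≤ n.choose k := div_pow_le_choose hkn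
  calc ((2 : ℝ) ^ k.choose 2) ^ 2 = (2 ^ (k - 1)) ^ k := two_pow_choose_two_sq k
    _ ≤ (((n : ℝ) / k) ^ 2) ^ k := by
      gcongr
      rw [div_pow, le_div_iff₀ (by positivity), mul_comm]
      exact h
    _ = (((n : ℝ) / k) ^ k) ^ 2 := pow_right_comm _ _ _
    _ ≤ _ := by gcongr

theorem kZero_le_and_fExp_kZero_lt_one {n : ℕ} (hn : 1 ≤ n) :
    (kZero n : ℝ) ≤ 2 * Real.logb 2 n + 2 ∧ fExp n (kZero n) < 1 := by
  have hn' : (1 : ℝ) ≤ n := by exact_mod_cast hn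
  have hL : 0 ≤ Real.logb 2 (n : ℝ) := Real.logb_nonneg one_lt_two hn'
  have hf : fExp n (⌊2 * Real.logb 2 (n : ℝ)⌋₊ + 2) < 1 := by
    refine fExp_lt_one (by lia) ?_
    have hlt := Nat.lt_floor_add_one (2 * Real.logb 2 (n : ℝ))
    calc (n : ℝ) ^ 2 = (2 : ℝ) ^ (2 * Real.logb 2 (n : ℝ)) := by
          rw [mul_comm, Real.rpow_mul zero_le_two,
            Real.rpow_logb zero_lt_two (by norm_num) (by positivity), Real.rpow_two]
      _ < (2 : ℝ) ^ ((⌊2 * Real.logb 2 (n : ℝ)⌋₊ + 1 : ℕ) : ℝ) :=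
          Real.rpow_lt_rpow_of_exponent_lt one_lt_two (by push_cast; exact hlt)
      _ = _ := by rw [Real.rpow_natCast]; rfl
  refine ⟨?_, Nat.sInf_mem (s := {k | fExp n k < 1}) ⟨_, hf⟩⟩
  have hle : kZero n ≤ ⌊2 * Real.logb 2 (n : ℝ)⌋₊ + 2 := Nat.sInf_le hf
  have hfloor := Nat.floor_le (mul_nonneg zero_le_two hL)
  have : (kZero n : ℝ) ≤ (⌊2 * Real.logb 2 (n : ℝ)⌋₊ : ℝ) + 2 := by exact_mod_cast hle
  linarith

theorem one_le_fExp_of_lt {ε : ℝ} (hε : 0 < ε) {n k : ℕ} (hn : 1 ≤ n)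
    (hlog : 2 * Real.logb 2 (n : ℝ) ≤ (n : ℝ) ^ (ε / 2))
    (hk : (k : ℝ) < (2 - ε) * Real.logb 2 n) : 1 ≤ fExp n k := by
  have hn' : (1 : ℝ) ≤ n := by exact_mod_cast hn
  have hn0 : (0 : ℝ) < n := by linarith
  have hL : 0 ≤ Real.logb 2 (n : ℝ) := Real.logb_nonneg one_lt_two hn'
  apply one_le_fExp
  have hkle : (k : ℝ) ≤ (n : ℝ) ^ (ε / 2) := by nlinarith
  have hpow : (2 : ℝ) ^ (k - 1) ≤ (n : ℝ) ^ (2 - ε) := by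
    calc (2 : ℝ) ^ (k - 1) ≤ 2 ^ k := pow_le_pow_right₀ one_le_two (Nat.sub_le k 1)
      _ = (2 : ℝ) ^ (k : ℝ) := (Real.rpow_natCast _ _).symm
      _ ≤ (2 : ℝ) ^ (Real.logb 2 n * (2 - ε)) :=
          Real.rpow_le_rpow_of_exponent_le one_le_two (by linarith)
      _ = (n : ℝ) ^ (2 - ε) := by
          rw [Real.rpow_mul zero_le_two, Real.rpow_logb zero_lt_two (by norm_num) hn0]
  calc (k : ℝ) ^ 2 * 2 ^ (k - 1) ≤ ((n : ℝ) ^ (ε / 2)) ^ 2 * (n : ℝ) ^ (2 - ε) := by gcongr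
    _ = (n : ℝ) ^ (2 : ℝ) := by
      rw [← Real.rpow_mul_natCast hn0.le, ← Real.rpow_add hn0]
      congr 1
      push_cast
      ring
    _ = (n : ℝ) ^ 2 := Real.rpow_two _

theorem eventually_two_mul_logb_le_rpow {δ : ℝ} (hδ : 0 < δ) :
    ∀ᶠ x : ℝ in Filter.atTop, 2 * Real.logb 2 x ≤ x ^ δ := by
  have hlog2 : 0 < Real.log 2 := Real.log_pos one_lt_two
  filter_upwards [(isLittleO_log_rpow_atTop hδ).bound (half_pos hlog2),
    Filter.eventually_ge_atTop 1] with x hx hx1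
  rw [Real.norm_of_nonneg (Real.log_nonneg hx1), Real.norm_of_nonneg (by positivity)] at hx
  rw [Real.logb, mul_div_assoc', div_le_iff₀ hlog2]
  linarith

/-- `k₀(n) ∼ 2·log₂ n`: for every `ε > 0` there is `N` such that for all `n ≥ N`,
`(2-ε)·log₂ n ≤ k₀(n) ≤ (2+ε)·log₂ n`. -/
theorem stmt16 (ε : ℝ) (hε : 0 < ε) :
    ∃ N : ℕ, ∀ n, N ≤ n →
      (2 - ε) * Real.logb 2 (n : ℝ) ≤ (kZero n : ℝ) ∧
        (kZero n : ℝ) ≤ (2 + ε) * Real.logb 2 (n : ℝ) := by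
  rw [← Filter.eventually_atTop]
  filter_upwards [Filter.eventually_ge_atTop 1,
    tendsto_natCast_atTop_atTop.eventually (eventually_two_mul_logb_le_rpow (half_pos hε)),
    ((Real.tendsto_logb_atTop one_lt_two).comp tendsto_natCast_atTop_atTop).eventually_ge_atTop
      (2 / ε)] with n hn hlog hlarge
  obtain ⟨hle, hlt⟩ := kZero_le_and_fExp_kZero_lt_one hn
  refine ⟨?_, ?_⟩
  · by_contra! hk
    exact absurd hlt (not_lt.mpr (one_le_fExp_of_lt hε hn hlog hk))
  · have : 2 ≤ Real.logb 2 (n : ℝ) * ε := (div_le_iff₀ hε).mp hlarge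
    linarith
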